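/- Let α ∈ (0,1) ∪ (1,2) and t > 0, and define f_t^α(x) := (1/π) ∫_0^∞ cos(xy) e^{−t y^α} dy for x ∈ ℝ (the integrand is Lebesgue integrable on (0,∞)). Then for every x ∈ ℝ one has 0 < f_t^α(x) ≤ (1/π) ∫_0^∞ e^{−t y^α} dy < ∞; i.e., the density of the symmetric α-stable distribution at time t is everywhere strictly positive and finite. -/

import Mathlib

open MeasureTheory Real Set

noncomputable section

namespace LevyBridge

/-- The density of the symmetric `α`-stable distribution at time `t`, obtained by
Fourier inversion: `f_t^α(x) = (1/π) ∫_0^∞ cos(xy) e^{−t y^α} dy`. -/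
def stableDensity (α t x : ℝ) : ℝ :=
  (1 / Real.pi) * ∫ y in Ioi (0 : ℝ), Real.cos (x * y) * Real.exp (-t * y ^ α)

open Filter Topology ProbabilityTheory
open scoped unitInterval

lemma integrableOn_one_sub_exp_neg_mul_rpow {β : ℝ} (h0 : 0 < β) (h1 : β < 1) {l : ℝ}
    (hl : 0 ≤ l) :
    IntegrableOn (fun s : ℝ => (1 - exp (-(l * s))) * s ^ (-(β + 1))) (Ioi 0) := by
  have hm : Measurable fun s : ℝ => (1 - exp (-(l * s))) * s ^ (-(β + 1)) := by fun_prop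
  rw [← Ioc_union_Ioi_eq_Ioi (zero_le_one : (0 : ℝ) ≤ 1)]
  refine IntegrableOn.union ?_ ?_
  · have hi : IntegrableOn (fun s : ℝ => l * s ^ (-β)) (Ioc 0 1) := by
      refine Integrable.const_mul ?_ l
      exact (intervalIntegrable_iff_integrableOn_Ioc_of_le zero_le_one).1
        (intervalIntegral.intervalIntegrable_rpow' (by linarith))
    refine Integrable.mono' hi hm.aestronglyMeasurable ?_
    filter_upwards [ae_restrict_mem measurableSet_Ioc] with s hs
    have hs0 : 0 < s := hs.1
    have hls : 0 ≤ l * s := by positivity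
    have he : exp (-(l * s)) ≤ 1 := exp_le_one_iff.2 (by linarith)
    have he' : 1 - exp (-(l * s)) ≤ l * s := by linarith [add_one_le_exp (-(l * s))]
    rw [norm_of_nonneg (mul_nonneg (by linarith) (by positivity))]
    have hpow : s ^ (-β) = s * s ^ (-(β + 1)) := by
      rw [← rpow_one_add' hs0.le (by linarith)]
      congr 1
      ring
    rw [hpow, ← mul_assoc]
    gcongr
  · have hi : IntegrableOn (fun s : ℝ => s ^ (-(β + 1))) (Ioi 1) :=
      integrableOn_Ioi_rpow_of_lt (by linarith) zero_lt_one
    refine Integrable.mono' hi hm.aestronglyMeasurable ?_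
    filter_upwards [ae_restrict_mem measurableSet_Ioi] with s hs
    have hs0 : 0 < s := zero_lt_one.trans hs
    have hls : 0 ≤ l * s := by positivity
    have he : exp (-(l * s)) ≤ 1 := exp_le_one_iff.2 (by linarith)
    rw [norm_of_nonneg (mul_nonneg (by linarith) (by positivity))]
    exact mul_le_of_le_one_left (by positivity) (by linarith [exp_pos (-(l * s))])

lemma integral_one_sub_exp_neg_mul_rpow_pos {β : ℝ} (h0 : 0 < β) (h1 : β < 1) :
    0 < ∫ s in Ioi (0 : ℝ), (1 - exp (-s)) * s ^ (-(β + 1)) := by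
  have hi := integrableOn_one_sub_exp_neg_mul_rpow h0 h1 zero_le_one
  simp only [one_mul] at hi
  have hpos : ∀ s ∈ Ioi (0 : ℝ), 0 < (1 - exp (-s)) * s ^ (-(β + 1)) := fun s hs =>
    mul_pos (sub_pos.2 (exp_lt_one_iff.2 (neg_neg_of_pos hs))) (rpow_pos_of_pos hs _)
  rw [setIntegral_pos_iff_support_of_nonneg_ae
    ((ae_restrict_mem measurableSet_Ioi).mono fun s hs => (hpos s hs).le) hi,
    inter_eq_right.2 fun s hs => Function.mem_support.2 (hpos s hs).ne']
  simp

/-- The Bernstein representation of `l ^ β`, up to the normalising constant. -/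
lemma integral_one_sub_exp_neg_mul_mul_rpow {β l : ℝ} (hl : 0 < l) :
    ∫ s in Ioi (0 : ℝ), (1 - exp (-(l * s))) * s ^ (-(β + 1)) =
      l ^ β * ∫ s in Ioi (0 : ℝ), (1 - exp (-s)) * s ^ (-(β + 1)) := by
  have h := integral_comp_mul_left_Ioi
    (fun s : ℝ => (1 - exp (-s)) * s ^ (-(β + 1))) 0 hl
  have h' : ∫ s in Ioi (0 : ℝ), (1 - exp (-(l * s))) * (l * s) ^ (-(β + 1)) =
      l ^ (-(β + 1)) * ∫ s in Ioi (0 : ℝ), (1 - exp (-(l * s))) * s ^ (-(β + 1)) := by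
    rw [← integral_const_mul]
    refine setIntegral_congr_fun measurableSet_Ioi fun s hs => ?_
    simp only [mul_rpow hl.le (le_of_lt hs)]
    ring
  rw [h', mul_zero, smul_eq_mul, rpow_neg hl.le, rpow_add hl, rpow_one] at h
  have := rpow_pos_of_pos hl β
  field_simp at h
  linarith

lemma integrable_coe_rpow (μ : Measure I) [IsFiniteMeasure μ] (l : ℝ) (hl : 0 ≤ l) :
    Integrable (fun z : I => (z : ℝ) ^ l) μ := by
  refine Integrable.of_bound (C := 1) (Measurable.aestronglyMeasurable (by fun_prop))
    (ae_of_all _ fun z => ?_)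
  rw [norm_of_nonneg (rpow_nonneg z.2.1 _)]
  exact rpow_le_one z.2.1 z.2.2 hl

/-- Powers of the moment function of a probability measure on the unit interval are moment
functions, by multiplicative convolution. -/
lemma exists_probabilityMeasure_moment_pow (μ : ProbabilityMeasure I) (n : ℕ) :
    ∃ ν : ProbabilityMeasure I, ∀ l : ℝ, 0 < l →
      ∫ z : I, (z : ℝ) ^ l ∂(ν : Measure I) = (∫ z : I, (z : ℝ) ^ l ∂(μ : Measure I)) ^ n := by
  induction n with
  | zero => exact ⟨⟨Measure.dirac 1, inferInstance⟩, fun l _ => by simp⟩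
  | succ n ih =>
    obtain ⟨ν, hν⟩ := ih
    refine ⟨⟨(ν : Measure I).mconv μ, inferInstance⟩, fun l hl => ?_⟩
    simp only [ProbabilityMeasure.coe_mk]
    rw [integral_mconv (integrable_coe_rpow _ l hl.le)]
    simp only [Icc.coe_mul, mul_rpow (unitInterval.nonneg _) (unitInterval.nonneg _),
      integral_const_mul, integral_mul_const]
    rw [hν l hl, pow_succ]

/-- The Pareto law transported to the unit interval by `s ↦ exp (-s)`. -/
lemma exists_probabilityMeasure_moment_pareto {β τ : ℝ} (hβ : 0 < β) (hτ : 0 < τ) :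
    ∃ ν : ProbabilityMeasure I, ∀ l : ℝ, 0 < l →
      ∫ z : I, (z : ℝ) ^ l ∂(ν : Measure I) =
        1 - β * τ ^ β * ∫ s in Ioi τ, (1 - exp (-(l * s))) * s ^ (-(β + 1)) := by
  have := isProbabilityMeasure_paretoMeasure hτ hβ
  let φ : ℝ → I := fun s => projIcc 0 1 zero_le_one (exp (-s))
  have hφ : Measurable φ := (continuous_projIcc.comp (by fun_prop)).measurable
  refine ⟨⟨(paretoMeasure τ β).map φ, Measure.isProbabilityMeasure_map hφ.aemeasurable⟩,
    fun l hl => ?_⟩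
  simp only [ProbabilityMeasure.coe_mk]
  have := Measure.isProbabilityMeasure_map (μ := paretoMeasure τ β) hφ.aemeasurable
  rw [eq_sub_iff_add_eq', ← eq_sub_iff_add_eq]
  have hsub : 1 - ∫ z : I, (z : ℝ) ^ l ∂((paretoMeasure τ β).map φ) =
      ∫ z : I, (1 - (z : ℝ) ^ l) ∂((paretoMeasure τ β).map φ) := by
    rw [integral_sub (integrable_const _) (integrable_coe_rpow _ l hl.le)]
    simp
  symm
  rw [hsub,
    integral_map hφ.aemeasurable (Measurable.aestronglyMeasurable (by fun_prop)),
    paretoMeasure, integral_withDensity_eq_integral_toReal_smul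
      (show Measurable (paretoPDF τ β) from (measurable_paretoPDFReal τ β).ennreal_ofReal)
      (ae_of_all _ fun _ => ENNReal.ofReal_lt_top),
    ← integral_const_mul, ← integral_Ici_eq_integral_Ioi, ← integral_indicator measurableSet_Ici]
  refine integral_congr_ae (ae_of_all _ fun s => ?_)
  simp only [paretoPDF, ENNReal.toReal_ofReal (paretoPDFReal_nonneg hτ.le hβ.le s), smul_eq_mul]
  by_cases hs : τ ≤ s
  · have hs0 : 0 < s := hτ.trans_le hs
    have hmem : exp (-s) ∈ Icc (0 : ℝ) 1 := ⟨(exp_pos _).le, exp_le_one_iff.2 (by linarith)⟩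
    rw [indicator_of_mem (mem_Ici.2 hs), paretoPDFReal, if_pos hs]
    simp only [φ, projIcc_of_mem _ hmem]
    rw [← exp_mul, show -s * l = -(l * s) by ring]
    ring
  · rw [indicator_of_notMem (by simpa using hs), paretoPDFReal, if_neg hs, zero_mul]

/-- The one-sided `β`-stable law, transported to the unit interval by `s ↦ exp (-s)`. -/
theorem exists_probabilityMeasure_moment_eq_exp_neg_rpow {β t : ℝ} (h0 : 0 < β) (h1 : β < 1)
    (ht : 0 < t) :
    ∃ μ : ProbabilityMeasure I, ∀ l : ℝ, 0 < l →
      ∫ z : I, (z : ℝ) ^ l ∂(μ : Measure I) = exp (-t * l ^ β) := by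
  set D := ∫ s in Ioi (0 : ℝ), (1 - exp (-s)) * s ^ (-(β + 1)) with hD
  have hDpos : 0 < D := integral_one_sub_exp_neg_mul_rpow_pos h0 h1
  let K : ℝ := t / (β * D)
  have hK : 0 < K := by positivity
  let τ : ℕ → ℝ := fun n => (K / (n + 1)) ^ β⁻¹
  have hτ : ∀ n, 0 < τ n := fun n => by positivity
  have hτβ : ∀ n, τ n ^ β = K / (n + 1) := fun n => rpow_inv_rpow (by positivity) h0.ne'
  have hτlim : Tendsto τ atTop (𝓝 0) := by
    have hlim : Tendsto (fun n : ℕ => K / ((n : ℝ) + 1)) atTop (𝓝 0) :=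
      (tendsto_const_div_atTop_nhds_zero_nat K).comp (tendsto_add_atTop_nat 1) |>.congr
        fun n => by simp
    have := hlim.rpow_const (p := β⁻¹) (Or.inr (by positivity))
    rwa [zero_rpow (by positivity)] at this
  choose ν hν using fun n => exists_probabilityMeasure_moment_pareto h0 (hτ n)
  choose μ hμ using fun n => exists_probabilityMeasure_moment_pow (ν n) n
  have hlim : ∀ l : ℝ, 0 < l → Tendsto (fun n => ∫ z : I, (z : ℝ) ^ l ∂(μ n : Measure I)) atTop
      (𝓝 (exp (-t * l ^ β))) := by
    intro l hl
    simp only [hμ _ l hl, hν _ l hl, sub_eq_add_neg (1 : ℝ) (_ * _)]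
    refine tendsto_one_add_pow_exp_of_tendsto ?_
    have hJ := (aecover_Ioi_of_Ioi (μ := volume) hτlim).integral_tendsto_of_countably_generated
      (integrableOn_one_sub_exp_neg_mul_rpow h0 h1 hl.le)
    rw [integral_one_sub_exp_neg_mul_mul_rpow hl, ← hD] at hJ
    have hn : Tendsto (fun n : ℕ => -(β * K) * ((n : ℝ) / (n + 1))) atTop
        (𝓝 (-(β * K) * 1)) := tendsto_natCast_div_add_atTop 1 |>.const_mul _
    have hprod := hn.mul hJ
    have heq : -(β * K) * 1 * (l ^ β * D) = -t * l ^ β := by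
      simp only [K]
      field_simp
    rw [heq] at hprod
    refine hprod.congr fun n => ?_
    rw [hτβ, Measure.restrict_restrict measurableSet_Ioi,
      inter_eq_left.2 (Ioi_subset_Ioi (hτ n).le)]
    ring
  obtain ⟨μ', -, hμ'⟩ := isCompact_univ.ultrafilter_le_nhds
    (Ultrafilter.map μ (hyperfilter ℕ)) (by simp)
  refine ⟨μ', fun l hl => ?_⟩
  have hconv : Tendsto μ (hyperfilter ℕ) (𝓝 μ') := hμ'
  have hc : Continuous fun z : I => (z : ℝ) ^ l :=
    (continuous_rpow_const hl.le).comp continuous_subtype_val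
  have h := ProbabilityMeasure.tendsto_iff_forall_integral_tendsto.1 hconv
    (BoundedContinuousFunction.mkOfCompact ⟨_, hc⟩)
  exact tendsto_nhds_unique h ((hlim l hl).mono_left Nat.hyperfilter_le_atTop)

lemma integral_cos_mul_exp_neg_mul_sq_pos (x : ℝ) {b : ℝ} (hb : 0 < b) :
    0 < ∫ y in Ioi (0 : ℝ), cos (x * y) * exp (-b * y ^ 2) := by
  have h2 : ∫ y : ℝ, cos (x * y) * exp (-b * y ^ 2) =
      2 * ∫ y in Ioi (0 : ℝ), cos (x * y) * exp (-b * y ^ 2) := by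
    rw [← integral_comp_abs (f := fun y => cos (x * y) * exp (-b * y ^ 2))]
    refine integral_congr_ae (ae_of_all _ fun y => ?_)
    rcases abs_choice y with h | h <;> simp [h]
  have hF := fourierIntegral_gaussian (b := (b : ℂ)) (by simpa using hb) (x : ℂ)
  have hint : Integrable fun y : ℝ =>
      Complex.exp (Complex.I * x * y) * Complex.exp (-(b : ℂ) * (y : ℂ) ^ 2) := by
    refine (integrable_exp_neg_mul_sq hb).mono' (Continuous.aestronglyMeasurable (by fun_prop))
      (ae_of_all _ fun y => ?_)
    rw [norm_mul, show Complex.I * x * y = ((x * y : ℝ) : ℂ) * Complex.I by push_cast; ring,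
      Complex.norm_exp_ofReal_mul_I, one_mul,
      show -(b : ℂ) * (y : ℂ) ^ 2 = ((-b * y ^ 2 : ℝ) : ℂ) by push_cast; ring,
      Complex.norm_exp_ofReal]
  have hre := congrArg Complex.re hF
  have hre' : ∫ y : ℝ, cos (x * y) * exp (-b * y ^ 2) = (∫ y : ℝ,
      Complex.exp (Complex.I * x * y) * Complex.exp (-(b : ℂ) * (y : ℂ) ^ 2)).re := by
    rw [← RCLike.re_eq_complex_re, ← integral_re hint]
    refine integral_congr_ae (ae_of_all _ fun y => ?_)
    simp only [RCLike.re_eq_complex_re]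
    rw [show Complex.I * x * y = ((x * y : ℝ) : ℂ) * Complex.I by push_cast; ring,
      show -(b : ℂ) * (y : ℂ) ^ 2 = ((-b * y ^ 2 : ℝ) : ℂ) by push_cast; ring,
      ← Complex.ofReal_exp, Complex.re_mul_ofReal, Complex.exp_ofReal_mul_I_re]
  have hval : ((π / b : ℂ) ^ (1 / 2 : ℂ) * Complex.exp (-(x : ℂ) ^ 2 / (4 * b))) =
      (((π / b) ^ (1 / 2 : ℝ) * exp (-x ^ 2 / (4 * b)) : ℝ) : ℂ) := by
    push_cast [Complex.ofReal_cpow (show 0 ≤ π / b by positivity)]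
    rfl
  rw [hval, Complex.ofReal_re, ← hre', h2] at hre
  have : 0 < (π / b) ^ (1 / 2 : ℝ) * exp (-x ^ 2 / (4 * b)) := by positivity
  linarith

lemma integrableOn_exp_neg_mul_rpow {α t : ℝ} (hα : 0 < α) (ht : 0 < t) :
    IntegrableOn (fun y : ℝ => exp (-t * y ^ α)) (Ioi 0) := by
  simpa using integrableOn_rpow_mul_exp_neg_mul_rpow (s := 0) (by norm_num) hα ht

lemma integrableOn_cos_mul_exp_neg_mul_rpow {α t : ℝ} (hα : 0 < α) (ht : 0 < t) (x : ℝ) :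
    IntegrableOn (fun y : ℝ => cos (x * y) * exp (-t * y ^ α)) (Ioi 0) :=
  (integrableOn_exp_neg_mul_rpow hα ht).bdd_mul (c := 1)
    (Continuous.aestronglyMeasurable (by fun_prop)) (ae_of_all _ fun y => abs_cos_le_one _)

lemma measure_singleton_one_eq_zero {β t : ℝ} (h0 : 0 < β) (ht : 0 < t)
    {μ : ProbabilityMeasure I}
    (hμ : ∀ l : ℝ, 0 < l → ∫ z : I, (z : ℝ) ^ l ∂(μ : Measure I) = exp (-t * l ^ β)) :
    (μ : Measure I) {1} = 0 := by
  have hle : ∀ᶠ l : ℝ in atTop, (μ : Measure I).real {1} ≤ exp (-t * l ^ β) := by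
    filter_upwards [eventually_gt_atTop 0] with l hl
    rw [← hμ l hl, ← integral_indicator_one (measurableSet_singleton _)]
    refine integral_mono ((integrable_const (1 : ℝ)).indicator (measurableSet_singleton _))
      (integrable_coe_rpow _ l hl.le) fun z => ?_
    refine indicator_le' (f := (1 : I → ℝ)) (g := fun z : I => (z : ℝ) ^ l)
      (fun z hz => ?_) (fun z _ => ?_) z
    · rw [mem_singleton_iff.1 hz]
      simp
    · exact rpow_nonneg z.2.1 _
  have hlim : Tendsto (fun l : ℝ => exp (-t * l ^ β)) atTop (𝓝 0) :=
    tendsto_exp_atBot.comp ((tendsto_rpow_atTop h0).const_mul_atTop_of_neg (neg_neg_of_pos ht))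
  exact (measureReal_eq_zero_iff).1 (le_antisymm (ge_of_tendsto hlim hle) measureReal_nonneg)

/-- Positivity of the cosine transform, via the representation of `exp (-t * y ^ α)` as a mixture
of Gaussians. -/
theorem integral_cos_mul_exp_neg_mul_rpow_pos {α t : ℝ} (h0 : 0 < α) (h2 : α < 2) (ht : 0 < t)
    (x : ℝ) : 0 < ∫ y in Ioi (0 : ℝ), cos (x * y) * exp (-t * y ^ α) := by
  have hβ : 0 < α / 2 := by positivity
  obtain ⟨μ, hμ⟩ := exists_probabilityMeasure_moment_eq_exp_neg_rpow hβ (by linarith) ht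
  have hone := measure_singleton_one_eq_zero hβ ht hμ
  have hmix : ∀ y ∈ Ioi (0 : ℝ),
      ∫ z : I, (z : ℝ) ^ (y ^ 2) ∂(μ : Measure I) = exp (-t * y ^ α) := fun y hy => by
    rw [hμ _ (pow_pos hy 2), ← rpow_natCast, ← rpow_mul (le_of_lt hy)]
    congr 3
    push_cast
    ring
  let F : ℝ → I → ℝ := fun y z => cos (x * y) * (z : ℝ) ^ (y ^ 2)
  have hFm : Measurable (Function.uncurry F) := by
    simp only [F, Function.uncurry_def]
    fun_prop
  have hF : Integrable (Function.uncurry F) ((volume.restrict (Ioi 0)).prod μ) := by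
    rw [integrable_prod_iff hFm.aestronglyMeasurable]
    refine ⟨ae_of_all _ fun y =>
      (integrable_coe_rpow μ (y ^ 2) (sq_nonneg y)).const_mul (cos (x * y)), ?_⟩
    refine (integrableOn_exp_neg_mul_rpow h0 ht).mono'
      hFm.norm.stronglyMeasurable.integral_prod_right.aestronglyMeasurable ?_
    filter_upwards [ae_restrict_mem measurableSet_Ioi] with y hy
    rw [norm_of_nonneg (integral_nonneg fun z => norm_nonneg _), ← hmix y hy]
    refine integral_mono_of_nonneg (ae_of_all _ fun z => norm_nonneg _)
      (integrable_coe_rpow _ _ (sq_nonneg y)) (ae_of_all _ fun z => ?_)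
    simp only [Function.uncurry_apply_pair, F, norm_mul, norm_of_nonneg (rpow_nonneg z.2.1 (y ^ 2))]
    exact mul_le_of_le_one_left (rpow_nonneg z.2.1 _) (abs_cos_le_one _)
  have hswap : ∫ y in Ioi (0 : ℝ), cos (x * y) * exp (-t * y ^ α) =
      ∫ z : I, (∫ y in Ioi (0 : ℝ), F y z) ∂(μ : Measure I) := by
    rw [← integral_integral_swap hF]
    refine setIntegral_congr_fun measurableSet_Ioi fun y hy => ?_
    simp only [F, integral_const_mul, hmix y hy]
  have hzero : ∫ y in Ioi (0 : ℝ), F y 0 = 0 :=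
    setIntegral_eq_zero_of_forall_eq_zero fun y hy => by
      simp [F, zero_rpow (pow_pos (mem_Ioi.1 hy) 2).ne']
  have hpos : ∀ z : I, z ≠ 0 → z ≠ 1 → 0 < ∫ y in Ioi (0 : ℝ), F y z := fun z hz0 hz1 => by
    have hz0' : 0 < (z : ℝ) := unitInterval.pos_iff_ne_zero.2 hz0
    have hz1' : (z : ℝ) < 1 := unitInterval.lt_one_iff_ne_one.2 hz1
    have := integral_cos_mul_exp_neg_mul_sq_pos x (neg_pos.2 (log_neg hz0' hz1'))
    simpa only [F, rpow_def_of_pos hz0', neg_neg] using this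
  have hne1 : ∀ᵐ z ∂(μ : Measure I), z ≠ 1 := by simpa [ae_iff] using hone
  have hG : Integrable (fun z : I => ∫ y in Ioi (0 : ℝ), F y z) μ := hF.integral_prod_right
  rw [hswap, integral_pos_iff_support_of_nonneg_ae ?_ hG]
  · refine pos_iff_ne_zero.2 fun hsupp => ?_
    have hae0 : ∀ᵐ z : I ∂(μ : Measure I), (z : ℝ) ^ (1 : ℝ) = 0 := by
      filter_upwards [hne1, measure_eq_zero_iff_ae_notMem.1 hsupp] with z hz1 hz
      by_contra hz0
      exact hz (hpos z (fun h => hz0 (by simp [h])) hz1).ne'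
    have h := hμ 1 one_pos
    rw [integral_eq_zero_of_ae hae0] at h
    exact (exp_pos _).ne h
  · filter_upwards [hne1] with z hz1
    rcases eq_or_ne z 0 with rfl | hz0
    · exact hzero.ge
    · exact (hpos z hz0 hz1).le

/-- for `α ∈ (0,1) ∪ (1,2)` and `t > 0`, the symmetric `α`-stable density
is everywhere strictly positive and bounded by the finite quantity
`(1/π) ∫_0^∞ e^{−t y^α} dy`. -/
theorem stableDensity_pos_le (α : ℝ) (hα : α ∈ Ioo (0 : ℝ) 1 ∪ Ioo (1 : ℝ) 2)
    (t : ℝ) (ht : 0 < t) :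
    (∀ x : ℝ, IntegrableOn (fun y => Real.cos (x * y) * Real.exp (-t * y ^ α))
      (Ioi (0 : ℝ)) volume) ∧
    IntegrableOn (fun y => Real.exp (-t * y ^ α)) (Ioi (0 : ℝ)) volume ∧
    ∀ x : ℝ, 0 < stableDensity α t x ∧
      stableDensity α t x ≤ (1 / Real.pi) * ∫ y in Ioi (0 : ℝ), Real.exp (-t * y ^ α) := by
  have h0 : 0 < α := hα.elim (fun h => h.1) fun h => one_pos.trans h.1
  have h2 : α < 2 := hα.elim (fun h => h.2.trans one_lt_two) fun h => h.2
  refine ⟨integrableOn_cos_mul_exp_neg_mul_rpow h0 ht, integrableOn_exp_neg_mul_rpow h0 ht,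
    fun x => ⟨mul_pos (by positivity) (integral_cos_mul_exp_neg_mul_rpow_pos h0 h2 ht x),
      mul_le_mul_of_nonneg_left ?_ (by positivity)⟩⟩
  exact integral_mono (integrableOn_cos_mul_exp_neg_mul_rpow h0 ht x)
    (integrableOn_exp_neg_mul_rpow h0 ht) fun y =>
      mul_le_of_le_one_left (exp_pos _).le (cos_le_one _)

end LevyBridge
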